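/- For every φ ∈ L^p(Ω), p ∈ [1,∞), the unfolded functions T_ε(φ) converge strongly to φ (viewed as constant in y) in L^p(Ω × Y) as ε → 0. -/

import Mathlib

open MeasureTheory Set Filter

/-- The reference cell `Y = (−1/2, 1/2]³`. -/
def Ycell : Set (Fin 3 → ℝ) := {y | ∀ i, y i ∈ Set.Ioc (-(1/2) : ℝ) (1/2)}

/-- Integer-part map `[·]_Y : ℝ → ℤ` adapted to `Y = (−1/2,1/2]`: `z − [z]_Y ∈ (−1/2,1/2]`. -/
noncomputable def nint (z : ℝ) : ℤ := ⌈z - 1/2⌉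

/-- The cell `ε(ℓ + Y)`. -/
def cellY (ε : ℝ) (ℓ : Fin 3 → ℤ) : Set (Fin 3 → ℝ) :=
  {x | ∀ i, x i ∈ Set.Ioc (ε * ((ℓ i : ℝ) - 1/2)) (ε * ((ℓ i : ℝ) + 1/2))}

/-- `Ω_ε⁻`: the union of the ε-cells entirely contained in `Ω`. -/
def OmegaMinus (Ω : Set (Fin 3 → ℝ)) (ε : ℝ) : Set (Fin 3 → ℝ) :=
  ⋃ ℓ ∈ {ℓ : Fin 3 → ℤ | cellY ε ℓ ⊆ Ω}, cellY ε ℓ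

/-- The periodic unfolding operator `T_ε`:
`T_ε(φ)(x,y) = φ(ε[x/ε]_Y + εy)` on `Ω_ε⁻ × Y` and `0` on `(Ω \ Ω_ε⁻) × Y`. -/
noncomputable def unfold (ε : ℝ) (Ω : Set (Fin 3 → ℝ)) (φ : (Fin 3 → ℝ) → ℝ)
    (x y : Fin 3 → ℝ) : ℝ :=
  (OmegaMinus Ω ε).indicator (fun x => φ (fun i => ε * (nint (x i / ε) : ℝ) + ε * y i)) x

lemma cellY_eq_pi (ε : ℝ) (ℓ : Fin 3 → ℤ) :
    cellY ε ℓ = Set.univ.pi fun i => Set.Ioc (ε * ((ℓ i : ℝ) - 1/2)) (ε * ((ℓ i : ℝ) + 1/2)) := by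
  ext x
  simp [cellY]

lemma measurableSet_cellY (ε : ℝ) (ℓ : Fin 3 → ℤ) : MeasurableSet (cellY ε ℓ) := by
  rw [cellY_eq_pi]
  exact MeasurableSet.univ_pi fun _ => measurableSet_Ioc

lemma volume_cellY (ε : ℝ) (ℓ : Fin 3 → ℤ) : volume (cellY ε ℓ) = ENNReal.ofReal ε ^ 3 := by
  rw [cellY_eq_pi, Real.volume_pi_Ioc]
  have (i : Fin 3) : ε * ((ℓ i : ℝ) + 1/2) - ε * ((ℓ i : ℝ) - 1/2) = ε := by ring
  simp only [this, Finset.prod_const, Finset.card_univ, Fintype.card_fin]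

lemma Ycell_eq_cellY : Ycell = cellY 1 0 := by
  ext x
  simp [Ycell, cellY]

lemma measurableSet_Ycell : MeasurableSet Ycell := by
  rw [Ycell_eq_cellY]
  exact measurableSet_cellY _ _

lemma volume_Ycell : volume Ycell = 1 := by
  simp [Ycell_eq_cellY, volume_cellY]

lemma measurableSet_OmegaMinus (Ω : Set (Fin 3 → ℝ)) (ε : ℝ) :
    MeasurableSet (OmegaMinus Ω ε) :=
  MeasurableSet.biUnion (Set.to_countable _) fun _ _ => measurableSet_cellY _ _

lemma OmegaMinus_subset (Ω : Set (Fin 3 → ℝ)) (ε : ℝ) : OmegaMinus Ω ε ⊆ Ω :=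
  Set.iUnion₂_subset fun _ h => h

lemma measurable_nint : Measurable nint :=
  Int.measurable_ceil.comp (measurable_id.sub_const _)

lemma mem_cellY_iff {ε : ℝ} (hε : 0 < ε) {ℓ : Fin 3 → ℤ} {x : Fin 3 → ℝ} :
    x ∈ cellY ε ℓ ↔ ∀ i, nint (x i / ε) = ℓ i := by
  refine forall_congr' fun i => ?_
  rw [nint, Int.ceil_eq_iff, Set.mem_Ioc, ← lt_div_iff₀' hε, ← div_le_iff₀' hε]
  constructor <;> rintro ⟨h₁, h₂⟩ <;> constructor <;> linarith

lemma pairwise_disjoint_cellY {ε : ℝ} (hε : 0 < ε) :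
    Pairwise (Function.onFun Disjoint (cellY ε)) := by
  intro ℓ m h
  refine Set.disjoint_left.2 fun x hx hx' => h ?_
  rw [mem_cellY_iff hε] at hx hx'
  ext i
  rw [← hx i, hx' i]

lemma affine_mem_cellY_iff {ε : ℝ} (hε : 0 < ε) {ℓ : Fin 3 → ℤ} {y : Fin 3 → ℝ} :
    (fun i => ε * (ℓ i : ℝ) + ε * y i) ∈ cellY ε ℓ ↔ y ∈ Ycell := by
  refine forall_congr' fun i => ?_
  simp only [Set.mem_Ioc, ← mul_add, mul_lt_mul_iff_right₀ hε, mul_le_mul_iff_right₀ hε]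
  constructor <;> rintro ⟨h₁, h₂⟩ <;> constructor <;> linarith

lemma dist_le_of_mem_cellY {ε : ℝ} (hε : 0 < ε) {ℓ : Fin 3 → ℤ} {x z : Fin 3 → ℝ}
    (hx : x ∈ cellY ε ℓ) (hz : z ∈ cellY ε ℓ) : dist z x ≤ ε := by
  refine (dist_pi_le_iff hε.le).2 fun i => ?_
  obtain ⟨h₁, h₂⟩ := hx i
  obtain ⟨h₃, h₄⟩ := hz i
  rw [Real.dist_eq, abs_le]
  constructor <;> linarith

/-- Every point of an open set eventually lies in a cell contained in that set. -/
lemma eventually_mem_OmegaMinus {Ω : Set (Fin 3 → ℝ)} (hΩ : IsOpen Ω) {x : Fin 3 → ℝ}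
    (hx : x ∈ Ω) : ∀ᶠ ε in nhdsWithin (0 : ℝ) (Set.Ioi 0), x ∈ OmegaMinus Ω ε := by
  obtain ⟨r, hr, hrΩ⟩ := Metric.isOpen_iff.1 hΩ x hx
  filter_upwards [Ioo_mem_nhdsGT hr] with ε hε
  have hxc : x ∈ cellY ε fun i => nint (x i / ε) := (mem_cellY_iff hε.1).2 fun _ => rfl
  exact Set.mem_biUnion
    (fun z hz => hrΩ ((dist_le_of_mem_cellY hε.1 hxc hz).trans_lt hε.2)) hxc

/-- Rescaling the reference cell onto `ε(ℓ + Y)`. -/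
lemma lintegral_cellY {ε : ℝ} (hε : 0 < ε) (ℓ : Fin 3 → ℤ) (f : (Fin 3 → ℝ) → ENNReal) :
    ENNReal.ofReal ε ^ 3 * ∫⁻ y in Ycell, f (fun i => ε * (ℓ i : ℝ) + ε * y i) =
      ∫⁻ x in cellY ε ℓ, f x := by
  set c : Fin 3 → ℝ := fun i => ε * (ℓ i : ℝ)
  have hc (y : Fin 3 → ℝ) : (fun i => ε * (ℓ i : ℝ) + ε * y i) = c + ε • y := by
    ext i
    simp [c]
  have hind (y : Fin 3 → ℝ) : Ycell.indicator (fun y => f (c + ε • y)) y =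
      (cellY ε ℓ).indicator f (c + ε • y) := by
    have := affine_mem_cellY_iff hε (ℓ := ℓ) (y := y)
    rw [hc] at this
    by_cases hy : y ∈ Ycell
    · rw [Set.indicator_of_mem hy, Set.indicator_of_mem (this.2 hy)]
    · rw [Set.indicator_of_notMem hy, Set.indicator_of_notMem (mt this.1 hy)]
  simp only [hc]
  rw [← lintegral_indicator measurableSet_Ycell, ← lintegral_indicator (measurableSet_cellY _ _)]
  simp only [hind]
  have hemb : MeasurableEmbedding fun y : Fin 3 → ℝ => ε • y :=
    (Homeomorph.smulOfNeZero ε hε.ne').measurableEmbedding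
  rw [← hemb.lintegral_map (fun z => (cellY ε ℓ).indicator f (c + z)),
    Measure.map_addHaar_smul _ hε.ne', lintegral_smul_measure,
    lintegral_add_left_eq_self (fun z => (cellY ε ℓ).indicator f z) c,
    smul_eq_mul, ← mul_assoc, Module.finrank_fin_fun, abs_of_pos (by positivity),
    ← ENNReal.ofReal_pow hε.le, ← ENNReal.ofReal_mul (by positivity),
    mul_inv_cancel₀ (by positivity), ENNReal.ofReal_one, one_mul]

/-- The unfolding operator preserves integrals over `Ω_ε⁻`. -/
lemma lintegral_unfolded {ε : ℝ} (hε : 0 < ε) (Ω : Set (Fin 3 → ℝ))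
    (f : (Fin 3 → ℝ) → ENNReal) :
    ∫⁻ x in OmegaMinus Ω ε, ∫⁻ y in Ycell, f (fun i => ε * (nint (x i / ε) : ℝ) + ε * y i) =
      ∫⁻ x in OmegaMinus Ω ε, f x := by
  have hd : {ℓ : Fin 3 → ℤ | cellY ε ℓ ⊆ Ω}.PairwiseDisjoint (cellY ε) :=
    fun _ _ _ _ h => pairwise_disjoint_cellY hε h
  rw [OmegaMinus, lintegral_biUnion (Set.to_countable _) (fun _ _ => measurableSet_cellY _ _) hd,
    lintegral_biUnion (Set.to_countable _) (fun _ _ => measurableSet_cellY _ _) hd]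
  refine tsum_congr fun ℓ => ?_
  rw [← lintegral_cellY hε ℓ.1 f, ← volume_cellY ε ℓ.1, mul_comm, ← setLIntegral_const]
  refine setLIntegral_congr_fun (measurableSet_cellY _ _) fun x hx => ?_
  simp only [(mem_cellY_iff hε).1 hx]

lemma lintegral_unfold_rpow_le {ε : ℝ} (hε : 0 < ε) (Ω : Set (Fin 3 → ℝ)) {p : ℝ} (hp : 0 < p)
    (f : (Fin 3 → ℝ) → ℝ) :
    ∫⁻ x in Ω, ∫⁻ y in Ycell, ‖unfold ε Ω f x y‖ₑ ^ p ≤ ∫⁻ x in Ω, ‖f x‖ₑ ^ p := by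
  have h (x : Fin 3 → ℝ) : ∫⁻ y in Ycell, ‖unfold ε Ω f x y‖ₑ ^ p =
      (OmegaMinus Ω ε).indicator (fun x => ∫⁻ y in Ycell,
        ‖f (fun i => ε * (nint (x i / ε) : ℝ) + ε * y i)‖ₑ ^ p) x := by
    by_cases hx : x ∈ OmegaMinus Ω ε <;> simp [unfold, hx, hp]
  simp only [h]
  rw [setLIntegral_indicator (measurableSet_OmegaMinus Ω ε),
    Set.inter_eq_left.2 (OmegaMinus_subset Ω ε),
    lintegral_unfolded hε Ω fun x => ‖f x‖ₑ ^ p]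
  exact lintegral_mono_set (OmegaMinus_subset Ω ε)

lemma measurable_unfold (ε : ℝ) (Ω : Set (Fin 3 → ℝ)) {g : (Fin 3 → ℝ) → ℝ} (hg : Measurable g) :
    Measurable fun z : (Fin 3 → ℝ) × (Fin 3 → ℝ) => unfold ε Ω g z.1 z.2 := by
  have hm : Measurable fun z : (Fin 3 → ℝ) × (Fin 3 → ℝ) =>
      g (fun i => ε * (nint (z.1 i / ε) : ℝ) + ε * z.2 i) := by
    refine hg.comp (measurable_pi_lambda _ fun i => ?_)
    have h₁ : Measurable fun z : (Fin 3 → ℝ) × (Fin 3 → ℝ) => (nint (z.1 i / ε) : ℝ) :=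
      (measurable_from_top (f := fun n : ℤ => (n : ℝ))).comp
        (measurable_nint.comp (by fun_prop))
    fun_prop
  exact hm.indicator (measurable_fst (measurableSet_OmegaMinus Ω ε))

lemma measurable_unfold_sub (ε : ℝ) (Ω : Set (Fin 3 → ℝ)) (p : ℝ) {g : (Fin 3 → ℝ) → ℝ}
    (hg : Measurable g) :
    Measurable fun z : (Fin 3 → ℝ) × (Fin 3 → ℝ) => ‖unfold ε Ω g z.1 z.2 - g z.1‖ₑ ^ p :=
  ((measurable_unfold ε Ω hg).sub (hg.comp measurable_fst)).enorm.pow_const p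

lemma measurable_unfold_sub_right (ε : ℝ) (Ω : Set (Fin 3 → ℝ)) (p : ℝ) {g : (Fin 3 → ℝ) → ℝ}
    (hg : Measurable g) (x : Fin 3 → ℝ) :
    Measurable fun y => ‖unfold ε Ω g x y - g x‖ₑ ^ p :=
  (measurable_unfold_sub ε Ω p hg).of_uncurry_left (f := fun x y => ‖unfold ε Ω g x y - g x‖ₑ ^ p)

lemma measurable_lintegral_unfold_sub (ε : ℝ) (Ω : Set (Fin 3 → ℝ)) (p : ℝ)
    {g : (Fin 3 → ℝ) → ℝ} (hg : Measurable g) :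
    Measurable fun x => ∫⁻ y in Ycell, ‖unfold ε Ω g x y - g x‖ₑ ^ p :=
  (measurable_unfold_sub ε Ω p hg).lintegral_prod_right'

lemma tendsto_unfold {Ω : Set (Fin 3 → ℝ)} (hΩ : IsOpen Ω) {g : (Fin 3 → ℝ) → ℝ}
    (hg : Continuous g) {x y : Fin 3 → ℝ} (hx : x ∈ Ω) (hy : y ∈ Ycell) :
    Tendsto (fun ε : ℝ => unfold ε Ω g x y) (nhdsWithin 0 (Set.Ioi 0)) (nhds (g x)) := by
  have h : Tendsto (fun ε : ℝ => fun i => ε * (nint (x i / ε) : ℝ) + ε * y i)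
      (nhdsWithin 0 (Set.Ioi 0)) (nhds x) := by
    rw [tendsto_iff_dist_tendsto_zero]
    refine squeeze_zero' (Eventually.of_forall fun _ => dist_nonneg) ?_
      (tendsto_nhdsWithin_of_tendsto_nhds tendsto_id)
    filter_upwards [self_mem_nhdsWithin] with ε hε
    exact dist_le_of_mem_cellY hε ((mem_cellY_iff hε).2 fun _ => rfl)
      ((affine_mem_cellY_iff hε).2 hy)
  refine ((hg.tendsto x).comp h).congr' ?_
  filter_upwards [eventually_mem_OmegaMinus hΩ hx] with ε hε
  rw [unfold, Set.indicator_of_mem hε, Function.comp_apply]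

open scoped BoundedContinuousFunction in
lemma tendsto_lintegral_unfold_sub {Ω : Set (Fin 3 → ℝ)} (hΩo : IsOpen Ω)
    (hΩ : volume Ω ≠ ⊤) {p : ℝ} (hp : 0 < p) (g : (Fin 3 → ℝ) →ᵇ ℝ) :
    Tendsto (fun ε : ℝ => ∫⁻ x in Ω, ∫⁻ y in Ycell, ‖unfold ε Ω g x y - g x‖ₑ ^ p)
      (nhdsWithin 0 (Set.Ioi 0)) (nhds 0) := by
  set M : ENNReal := (2 * ‖g‖ₑ) ^ p
  have hM : M ≠ ⊤ := by
    refine ENNReal.rpow_ne_top_of_nonneg hp.le (ENNReal.mul_ne_top (by simp) (by simp))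
  have hgm : Measurable g := g.continuous.measurable
  have hgx (x : Fin 3 → ℝ) : ‖g x‖ₑ ≤ ‖g‖ₑ := enorm_le_iff_norm_le.2 (g.norm_coe_le_norm x)
  have hY : ∫⁻ _ in Ycell, M = M := by rw [setLIntegral_const, volume_Ycell, mul_one]
  have hbound (ε : ℝ) (x y : Fin 3 → ℝ) : ‖unfold ε Ω g x y - g x‖ₑ ^ p ≤ M := by
    refine ENNReal.rpow_le_rpow ?_ hp.le
    rw [two_mul]
    refine enorm_sub_le.trans (add_le_add ?_ (hgx x))
    by_cases hx : x ∈ OmegaMinus Ω ε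
    · rw [unfold, Set.indicator_of_mem hx]
      exact hgx _
    · simp [unfold, hx]
  clear_value M
  have hinner (x : Fin 3 → ℝ) (hx : x ∈ Ω) :
      Tendsto (fun ε : ℝ => ∫⁻ y in Ycell, ‖unfold ε Ω g x y - g x‖ₑ ^ p)
        (nhdsWithin 0 (Set.Ioi 0)) (nhds 0) := by
    rw [← lintegral_zero (μ := volume.restrict Ycell)]
    refine tendsto_lintegral_filter_of_dominated_convergence (fun _ => M)
      (Eventually.of_forall fun ε => measurable_unfold_sub_right ε Ω p hgm x)
      (Eventually.of_forall fun ε => Eventually.of_forall fun y => hbound ε x y)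
      (by rwa [hY]) ?_
    filter_upwards [ae_restrict_mem measurableSet_Ycell] with y hy
    have h := ((tendsto_unfold hΩo g.continuous hx hy).sub_const (g x)).enorm.ennrpow_const p
    simpa [hp] using h
  rw [← lintegral_zero (μ := volume.restrict Ω)]
  refine tendsto_lintegral_filter_of_dominated_convergence (fun _ => M)
    (Eventually.of_forall fun ε => measurable_lintegral_unfold_sub ε Ω p hgm)
    (Eventually.of_forall fun ε => Eventually.of_forall fun x =>
      (lintegral_mono fun y => hbound ε x y).trans_eq hY)
    (by rw [setLIntegral_const]; exact ENNReal.mul_ne_top hM hΩ) ?_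
  filter_upwards [ae_restrict_mem hΩo.measurableSet] with x hx using hinner x hx

lemma unfold_sub (ε : ℝ) (Ω : Set (Fin 3 → ℝ)) (f g : (Fin 3 → ℝ) → ℝ) (x y : Fin 3 → ℝ) :
    unfold ε Ω (f - g) x y = unfold ε Ω f x y - unfold ε Ω g x y := by
  by_cases hx : x ∈ OmegaMinus Ω ε <;> simp [unfold, hx]

/-- Comparison of the unfolding errors of `f` and of a measurable approximation `g`. -/
lemma lintegral_unfold_sub_le {ε : ℝ} (hε : 0 < ε) {Ω : Set (Fin 3 → ℝ)} {p : ℝ} (hp : 1 ≤ p)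
    {f g : (Fin 3 → ℝ) → ℝ} (hf : AEStronglyMeasurable f (volume.restrict Ω))
    (hg : Measurable g) :
    ∫⁻ x in Ω, ∫⁻ y in Ycell, ‖unfold ε Ω f x y - f x‖ₑ ^ p ≤
      3 ^ (p - 1) * (2 * (∫⁻ x in Ω, ‖f x - g x‖ₑ ^ p) +
        ∫⁻ x in Ω, ∫⁻ y in Ycell, ‖unfold ε Ω g x y - g x‖ₑ ^ p) := by
  have hrw (x y : Fin 3 → ℝ) : unfold ε Ω f x y - f x =
      ∑ j, ![unfold ε Ω (f - g) x y, unfold ε Ω g x y - g x, g x - f x] j := by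
    simp only [Fin.sum_univ_three, unfold_sub, Matrix.cons_val]
    ring
  have hpt (x y : Fin 3 → ℝ) : ‖unfold ε Ω f x y - f x‖ₑ ^ p ≤
      3 ^ (p - 1) * (‖unfold ε Ω (f - g) x y‖ₑ ^ p + ‖unfold ε Ω g x y - g x‖ₑ ^ p +
        ‖f x - g x‖ₑ ^ p) := by
    rw [hrw]
    refine (ENNReal.rpow_le_rpow (enorm_sum_le _ _) (by linarith)).trans ?_
    refine (ENNReal.rpow_sum_le_const_mul_sum_rpow _ _ hp).trans_eq ?_
    simp [Fin.sum_univ_three, enorm_sub_rev (g x)]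
  have hC : (3 : ENNReal) ^ (p - 1) ≠ ⊤ :=
    ENNReal.rpow_ne_top_of_nonneg (by linarith) (by simp)
  have hmfg : AEMeasurable (fun x => ‖f x - g x‖ₑ ^ p) (volume.restrict Ω) :=
    ((hf.aemeasurable.sub hg.aemeasurable).enorm).pow_const p
  have hinner (x : Fin 3 → ℝ) : ∫⁻ y in Ycell, ‖unfold ε Ω f x y - f x‖ₑ ^ p ≤
      3 ^ (p - 1) * ((∫⁻ y in Ycell, ‖unfold ε Ω (f - g) x y‖ₑ ^ p) +
        (∫⁻ y in Ycell, ‖unfold ε Ω g x y - g x‖ₑ ^ p) + ‖f x - g x‖ₑ ^ p) := by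
    refine (lintegral_mono (hpt x)).trans_eq ?_
    rw [lintegral_const_mul' _ _ hC, lintegral_add_right _ measurable_const,
      lintegral_add_right _ (measurable_unfold_sub_right ε Ω p hg x), setLIntegral_const, volume_Ycell,
      mul_one]
  refine (lintegral_mono hinner).trans ?_
  rw [lintegral_const_mul' _ _ hC, lintegral_add_right' _ hmfg,
    lintegral_add_right _ (measurable_lintegral_unfold_sub ε Ω p hg), two_mul, add_right_comm]
  gcongr _ * (?_ + _ + _)
  exact lintegral_unfold_rpow_le hε Ω (by linarith) (f - g)

/-- For every `φ ∈ L^p(Ω)`, `p ∈ [1,∞)`, the unfolded functions `T_ε(φ)` converge strongly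
in `L^p(Ω × Y)` to `(x,y) ↦ φ(x)` as `ε → 0⁺`. -/
theorem stmt8 (Ω : Set (Fin 3 → ℝ)) (hΩo : IsOpen Ω) (hΩb : Bornology.IsBounded Ω)
    (p : ℝ) (hp : 1 ≤ p) (φ : (Fin 3 → ℝ) → ℝ)
    (hφm : AEStronglyMeasurable φ (volume.restrict Ω))
    (hφ : IntegrableOn (fun x => |φ x| ^ p) Ω) :
    Filter.Tendsto
      (fun ε : ℝ => ∫ x in Ω, ∫ y in Ycell, |unfold ε Ω φ x y - φ x| ^ p)
      (nhdsWithin 0 (Set.Ioi 0)) (nhds 0) := by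
  have hp0 : 0 < p := by linarith
  have hq0 : ENNReal.ofReal p ≠ 0 := by simpa using hp0
  have hq : (ENNReal.ofReal p).toReal = p := ENNReal.toReal_ofReal hp0.le
  have hmem : MemLp φ (ENNReal.ofReal p) (volume.restrict Ω) := by
    rw [← integrable_norm_rpow_iff hφm hq0 ENNReal.ofReal_ne_top, hq]
    exact hφ
  have hΩ : volume Ω ≠ ⊤ := hΩb.measure_lt_top.ne
  have : IsFiniteMeasure (volume.restrict Ω) := ⟨by simpa using hΩ.lt_top⟩
  have hlim : Tendsto (fun ε : ℝ => ∫⁻ x in Ω, ∫⁻ y in Ycell, ‖unfold ε Ω φ x y - φ x‖ₑ ^ p)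
      (nhdsWithin 0 (Set.Ioi 0)) (nhds 0) := by
    set C : ENNReal := 3 ^ (p - 1)
    have hC : C ≠ ⊤ := ENNReal.rpow_ne_top_of_nonneg (by linarith) (by simp)
    refine ENNReal.tendsto_nhds_zero.2 fun η hη => ?_
    have hcont : Tendsto (fun δ : ENNReal => C * (2 * δ ^ p + δ)) (nhds 0) (nhds 0) := by
      have h₁ : Tendsto (fun δ : ENNReal => δ ^ p) (nhds 0) (nhds 0) := by
        simpa [hp0] using (tendsto_id (α := ENNReal) (x := nhds 0)).ennrpow_const p
      have h₂ := ENNReal.Tendsto.const_mul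
        ((ENNReal.Tendsto.const_mul h₁ (Or.inr (ENNReal.ofNat_ne_top (n := 2)))).add tendsto_id)
        (Or.inr hC)
      simpa using h₂
    obtain ⟨δ, hδη, hδ⟩ := ((hcont.mono_left nhdsWithin_le_nhds).eventually
      (ge_mem_nhds hη) |>.and (self_mem_nhdsWithin (s := Set.Ioi (0 : ENNReal)))).exists
    obtain ⟨g, hg, -⟩ := hmem.exists_boundedContinuous_eLpNorm_sub_le ENNReal.ofReal_ne_top
      (ne_of_gt hδ)
    have hgδ : ∫⁻ x in Ω, ‖φ x - g x‖ₑ ^ p ≤ δ ^ p := by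
      rw [eLpNorm_eq_lintegral_rpow_enorm_toReal hq0 ENNReal.ofReal_ne_top, hq, one_div,
        ENNReal.rpow_inv_le_iff hp0] at hg
      exact hg
    filter_upwards [self_mem_nhdsWithin, (tendsto_lintegral_unfold_sub hΩo hΩ hp0 g).eventually
      (ge_mem_nhds hδ)] with ε hε hεδ
    refine (lintegral_unfold_sub_le hε hp hφm g.continuous.measurable).trans (le_trans ?_ hδη)
    gcongr
  rw [tendsto_zero_iff_enorm_tendsto_zero]
  refine tendsto_of_tendsto_of_tendsto_of_le_of_le tendsto_const_nhds hlim
    (fun _ => zero_le) fun ε => ?_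
  refine (enorm_integral_le_lintegral_enorm _).trans (lintegral_mono fun x => ?_)
  refine (enorm_integral_le_lintegral_enorm _).trans_eq (lintegral_congr fun y => ?_)
  rw [Real.enorm_rpow_of_nonneg (abs_nonneg _) hp0.le, Real.enorm_abs]
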